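/- arXiv:2402.18984 — 2 statements merged into one kernel-verified Lean document; each statement's English description precedes it below -/
import Mathlib

section
/- Let k ≥ 2 be an integer and let G be a finite connected P_k-free simple graph. Then the burning number of G satisfies b(G) ≤ ⌈(k+1)/2⌉. -/
open SimpleGraph

/-- `b` is a burning sequence of length `k` for `G`: the source `b i` is burned at time `i + 1`
(for `i : Fin k`), and every vertex must be within distance `k - (i + 1)` of some source `b i`
(expressed via the existence of a short enough walk, so that unreachable vertices are never
considered burned). -/
def IsBurningSeq {V : Type*} (G : SimpleGraph V) {k : ℕ} (b : Fin k → V) : Prop :=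
  ∀ v : V, ∃ i : Fin k, ∃ w : G.Walk v (b i), w.length + (i : ℕ) + 1 ≤ k

/-- The burning number of `G`: the least `k` admitting a burning sequence of length `k`. -/
noncomputable def burningNumber {V : Type*} (G : SimpleGraph V) : ℕ :=
  sInf {k : ℕ | ∃ b : Fin k → V, IsBurningSeq G b}

namespace BurnAux

open Classical in
/-- Connectedness of a finite vertex set, via cuts. -/
def Conn {V : Type*} (G : SimpleGraph V) (X : Finset V) : Prop :=
  ∀ A ⊆ X, A.Nonempty → A ≠ X → ∃ a ∈ A, ∃ b ∈ X, b ∉ A ∧ G.Adj a b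

/-- `p 0, ..., p (n-1)` is an induced path. -/
def IndPath {V : Type*} (G : SimpleGraph V) (n : ℕ) (p : ℕ → V) : Prop :=
  ∀ i j, i < j → j < n → p i ≠ p j ∧ (G.Adj (p i) (p j) ↔ j = i + 1)

/-- connected dominating set of `S`. -/
def CDS {V : Type*} (G : SimpleGraph V) (S X : Finset V) : Prop :=
  X ⊆ S ∧ Conn G X ∧ ∀ s ∈ S, s ∈ X ∨ ∃ x ∈ X, G.Adj s x

variable {V : Type*} {G : SimpleGraph V}

open Classical in
lemma conn_insert {X : Finset V} (hX : Conn G X) {x y : V} (hx : x ∈ X) (hxy : G.Adj x y) :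
    Conn G (insert y X) := by
  intro A hA hne hneq
  by_cases hy : y ∈ X
  · rw [Finset.insert_eq_of_mem hy] at *
    exact hX A hA hne hneq
  by_cases h1 : (A ∩ X).Nonempty
  · by_cases h2 : A ∩ X = X
    · have hXA : X ⊆ A := by
        intro z hz
        rw [← h2] at hz
        exact (Finset.mem_inter.1 hz).1
      have hyA : y ∉ A := by
        intro hyA
        apply hneq
        apply Finset.Subset.antisymm hA
        intro z hz
        rcases Finset.mem_insert.1 hz with rfl | hz
        · exact hyA
        · exact hXA hz
      exact ⟨x, hXA hx, y, Finset.mem_insert_self _ _, hyA, hxy⟩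
    · obtain ⟨a, ha, b, hb, hbA, hab⟩ := hX (A ∩ X) Finset.inter_subset_right h1 h2
      refine ⟨a, (Finset.mem_inter.1 ha).1, b, Finset.mem_insert_of_mem hb, ?_, hab⟩
      intro h
      exact hbA (Finset.mem_inter.2 ⟨h, hb⟩)
  · have hnX : ∀ z ∈ A, z ∉ X := fun z hz hzX => h1 ⟨z, Finset.mem_inter.2 ⟨hz, hzX⟩⟩
    obtain ⟨z, hz⟩ := hne
    have : z = y := by
      rcases Finset.mem_insert.1 (hA hz) with h | h
      · exact h
      · exact absurd h (hnX z hz)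
    subst this
    exact ⟨z, hz, x, Finset.mem_insert_of_mem hx, fun h => hnX x h hx, hxy.symm⟩

open Classical in
lemma conn_path {n : ℕ} {p : ℕ → V} (h : ∀ i, i + 1 < n → G.Adj (p i) (p (i + 1))) :
    Conn G ((Finset.range n).image p) := by
  induction n with
  | zero =>
    intro A hA hne
    obtain ⟨z, hz⟩ := hne
    simpa using hA hz
  | succ n ih =>
    rw [Finset.range_add_one, Finset.image_insert]
    rcases Nat.eq_zero_or_pos n with rfl | hn
    · intro A hA hne hneq
      exfalso
      apply hneq
      simp only [Finset.range_zero, Finset.image_empty] at hA ⊢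
      rcases Finset.subset_singleton_iff.1 hA with h | h
      · simp [h] at hne
      · exact h
    · obtain ⟨m, rfl⟩ : ∃ m, n = m + 1 := ⟨n - 1, by omega⟩
      refine conn_insert (x := p m) (ih fun i hi => h i (by omega)) ?_ (h m (by omega))
      exact Finset.mem_image_of_mem _ (by simp)

open Classical in
lemma keyF {S Y R : Finset V} (hY : CDS G S Y) (hRY : R ⊆ Y) (hR : Conn G R) {x : V}
    (hx : x ∈ Y) (hxR : x ∉ R) {r : V} (hr : r ∈ R) (hxr : G.Adj x r) :
    CDS G S (Y.erase x) ∨ ∃ y ∈ S, y ∉ R ∧ G.Adj x y ∧ (∀ z ∈ R, ¬ G.Adj y z) ∧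
      (y ∈ Y ∨ ∀ z ∈ Y, z ≠ x → ¬ G.Adj y z) := by
  obtain ⟨hYS, hYc, hYd⟩ := hY
  have hRe : R ⊆ Y.erase x := fun z hz =>
    Finset.mem_erase.2 ⟨fun h => hxR (h ▸ hz), hRY hz⟩
  by_cases hc : Conn G (Y.erase x)
  · by_cases hd : ∀ s ∈ S, s ∈ Y.erase x ∨ ∃ z ∈ Y.erase x, G.Adj s z
    · exact Or.inl ⟨(Finset.erase_subset _ _).trans hYS, hc, hd⟩
    · right
      push Not at hd
      obtain ⟨y, hyS, hy1, hy2⟩ := hd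
      have hyx : y ≠ x := by
        rintro rfl
        exact hy2 r (hRe hr) hxr
      have hyY : y ∉ Y := fun h => hy1 (Finset.mem_erase.2 ⟨hyx, h⟩)
      have hadj : G.Adj x y := by
        rcases hYd y hyS with h | ⟨z, hz, hyz⟩
        · exact absurd h hyY
        · by_cases hzx : z = x
          · subst hzx; exact hyz.symm
          · exact absurd hyz (hy2 z (Finset.mem_erase.2 ⟨hzx, hz⟩))
      exact ⟨y, hyS, fun h => hyY (hRY h), hadj, fun z hz => hy2 z (hRe hz),
        Or.inr fun z hz hzx => hy2 z (Finset.mem_erase.2 ⟨hzx, hz⟩)⟩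
  · right
    -- a side `B` of the cut avoiding `R`
    have hB : ∃ B ⊆ Y.erase x, B.Nonempty ∧ (∀ z ∈ R, z ∉ B) ∧
        ∀ a ∈ B, ∀ b ∈ Y.erase x, b ∉ B → ¬ G.Adj a b := by
      unfold Conn at hc
      push Not at hc
      obtain ⟨A, hA, hne, hneq, hcut⟩ := hc
      have hcase : (∀ z ∈ R, z ∉ A) ∨ R ⊆ A := by
        by_contra hcon
        push Not at hcon
        obtain ⟨⟨z, hzR, hzA⟩, hnot⟩ := hcon
        obtain ⟨a, ha, b, hb, hbA, hab⟩ := hR (A ∩ R) Finset.inter_subset_right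
          ⟨z, Finset.mem_inter.2 ⟨hzA, hzR⟩⟩ (fun h => hnot (by
            intro w hw
            rw [← h] at hw
            exact (Finset.mem_inter.1 hw).1))
        refine hcut a (Finset.mem_inter.1 ha).1 b (hRe hb) ?_ hab
        exact fun h => hbA (Finset.mem_inter.2 ⟨h, hb⟩)
      rcases hcase with h | h
      · exact ⟨A, hA, hne, h, hcut⟩
      · refine ⟨Y.erase x \ A, Finset.sdiff_subset, ?_, ?_, ?_⟩
        · rw [Finset.sdiff_nonempty]
          exact fun h' => hneq (Finset.Subset.antisymm hA h')
        · intro z hz hz'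
          exact (Finset.mem_sdiff.1 hz').2 (h hz)
        · intro a ha b hb hbn hab
          have hbA : b ∈ A := by
            by_contra hbA
            exact hbn (Finset.mem_sdiff.2 ⟨hb, hbA⟩)
          exact hcut b hbA a (Finset.mem_sdiff.1 ha).1 (Finset.mem_sdiff.1 ha).2 hab.symm
    obtain ⟨B, hBY, hBne, hBR, hcut⟩ := hB
    have hBY' : B ⊆ Y := hBY.trans (Finset.erase_subset _ _)
    obtain ⟨a, ha, b, hb, hbB, hab⟩ := hYc B hBY' hBne (by
      rintro rfl
      exact (Finset.mem_erase.1 (hBY hx)).1 rfl)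
    have hbx : b = x := by
      by_contra hbx
      exact hcut a ha b (Finset.mem_erase.2 ⟨hbx, hb⟩) hbB hab
    subst hbx
    exact ⟨a, hYS (hBY' ha), fun h => hBR a h ha, hab.symm,
      fun z hz => hcut a ha z (hRe hz) (hBR z hz), Or.inl (hBY' ha)⟩

/-- Prepend a vertex. -/
def pre (y : V) (p : ℕ → V) : ℕ → V
  | 0 => y
  | i + 1 => p i

lemma indPath_pre {n : ℕ} {p : ℕ → V} (hp : IndPath G n p) {y : V}
    (h0 : G.Adj (p 0) y) (h1 : ∀ i, i < n → p i ≠ y)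
    (h2 : ∀ i, 0 < i → i < n → ¬ G.Adj y (p i)) : IndPath G (n + 1) (pre y p) := by
  intro i j hij hj
  obtain ⟨j, rfl⟩ : ∃ m, j = m + 1 := ⟨j - 1, by omega⟩
  cases i with
  | zero =>
    refine ⟨(h1 j (by omega)).symm, ?_⟩
    change G.Adj y (p j) ↔ _
    rcases Nat.eq_zero_or_pos j with rfl | hj0
    · simp [h0.symm]
    · have := h2 j hj0 (by omega)
      simp [this]; omega
  | succ i =>
    have := hp i j (by omega) (by omega)
    refine ⟨this.1, ?_⟩
    change G.Adj (p i) (p j) ↔ _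
    rw [this.2]; omega

lemma indPath_app {n : ℕ} {p : ℕ → V} (hp : IndPath G (n + 1) p) {y : V}
    (h0 : G.Adj (p n) y) (h1 : ∀ i, i < n + 1 → p i ≠ y)
    (h2 : ∀ i, i < n → ¬ G.Adj y (p i)) : IndPath G (n + 2) (Function.update p (n + 1) y) := by
  intro i j hij hj
  rw [Function.update_of_ne (by omega : i ≠ n + 1)]
  by_cases hjn : j = n + 1
  · subst hjn
    rw [Function.update_self]
    refine ⟨h1 i hij, ?_⟩
    by_cases hin : i = n
    · subst hin; simp [h0]
    · have := h2 i (by omega)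
      rw [G.adj_comm] at this
      simp [this]; omega
  · rw [Function.update_of_ne hjn]
    exact hp i j hij (by omega)

open Classical in
lemma rotate {S : Finset V} {n m : ℕ} (hn : 2 ≤ n)
    (hfree : ¬ ∃ p, IndPath G (n + 2) p ∧ ∀ i < n + 2, p i ∈ S)
    (hmin : ∀ X, CDS G S X → m ≤ X.card)
    {X : Finset V} (hX : CDS G S X) (hm : X.card = m) {p : ℕ → V} (hp : IndPath G n p)
    (hpX : ∀ i < n, p i ∈ X) :
    ∃ y, y ∉ X ∧ (∀ z ∈ X, z ≠ p 0 → ¬ G.Adj y z) ∧ CDS G S ((insert y X).erase (p (n - 1))) ∧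
      IndPath G (n + 1) (pre y p) := by
  obtain ⟨k, rfl⟩ : ∃ k, n = k + 2 := ⟨n - 2, by omega⟩
  have hsub : ∀ i < k + 2, p i ∈ S := fun i hi => hX.1 (hpX i hi)
  have hadj : ∀ i, i + 1 < k + 2 → G.Adj (p i) (p (i + 1)) := fun i hi =>
    (hp i (i + 1) (by omega) hi).2.2 rfl
  have h1 := keyF (R := (Finset.range (k + 1)).image fun i => p (i + 1)) hX
    (by
      intro z hz
      obtain ⟨i, hi, rfl⟩ := Finset.mem_image.1 hz
      exact hpX _ (by have := Finset.mem_range.1 hi; omega))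
    (conn_path fun i hi => hadj (i + 1) (by omega)) (hpX 0 (by omega))
    (by
      intro hz
      obtain ⟨i, hi, h⟩ := Finset.mem_image.1 hz
      exact (hp 0 (i + 1) (by omega) (by have := Finset.mem_range.1 hi; omega)).1 h.symm)
    (r := p 1) (Finset.mem_image.2 ⟨0, by simp, rfl⟩) (hadj 0 (by omega))
  rcases h1 with h1 | ⟨y, hyS, hyR, hxy, hyadj, hy⟩
  · have := hmin _ h1
    rw [Finset.card_erase_of_mem (hpX 0 (by omega))] at this
    have := Finset.card_pos.2 ⟨_, hpX 0 (by omega)⟩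
    omega
  have hq : IndPath G (k + 2 + 1) (pre y p) := by
    refine indPath_pre hp hxy ?_ ?_
    · intro i hi h
      cases i with
      | zero => exact hxy.ne h
      | succ i => exact hyR (Finset.mem_image.2 ⟨i, by simp; omega, h⟩)
    · intro i hi0 hi
      obtain ⟨i, rfl⟩ : ∃ m, i = m + 1 := ⟨i - 1, by omega⟩
      exact hyadj _ (Finset.mem_image.2 ⟨i, by simp; omega, rfl⟩)
  have hY : CDS G S (insert y X) := by
    refine ⟨?_, conn_insert hX.2.1 (hpX 0 (by omega)) hxy, ?_⟩
    · intro z hz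
      rcases Finset.mem_insert.1 hz with rfl | hz
      · exact hyS
      · exact hX.1 hz
    · intro s hs
      rcases hX.2.2 s hs with h | ⟨x, hx, h⟩
      · exact Or.inl (Finset.mem_insert_of_mem h)
      · exact Or.inr ⟨x, Finset.mem_insert_of_mem hx, h⟩
  have hqY : ∀ i < k + 3, pre y p i ∈ insert y X := by
    intro i hi
    cases i with
    | zero => exact Finset.mem_insert_self _ _
    | succ i => exact Finset.mem_insert_of_mem (hpX i (by omega))
  have hqadj : ∀ i, i + 1 < k + 3 → G.Adj (pre y p i) (pre y p (i + 1)) := fun i hi =>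
    (hq i (i + 1) (by omega) hi).2.2 rfl
  have h2 := keyF (R := (Finset.range (k + 2)).image (pre y p)) hY
    (by
      intro z hz
      obtain ⟨i, hi, rfl⟩ := Finset.mem_image.1 hz
      exact hqY _ (by have := Finset.mem_range.1 hi; omega))
    (conn_path fun i hi => hqadj i (by omega)) (hqY (k + 2) (by omega))
    (by
      intro hz
      obtain ⟨i, hi, h⟩ := Finset.mem_image.1 hz
      exact (hq i (k + 2) (Finset.mem_range.1 hi) (by omega)).1 h)
    (r := pre y p (k + 1)) (Finset.mem_image.2 ⟨k + 1, by simp, rfl⟩)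
    (hqadj (k + 1) (by omega)).symm
  rcases h2 with h2 | ⟨y2, hy2S, hy2R, hxy2, hy2adj, -⟩
  · have hyX : y ∉ X := by
      intro hyX
      rw [Finset.insert_eq_of_mem hyX] at h2
      have := hmin _ h2
      have hmem : pre y p (k + 2) ∈ X := hpX (k + 1) (by omega)
      rw [Finset.card_erase_of_mem hmem] at this
      have := Finset.card_pos.2 ⟨_, hmem⟩
      omega
    exact ⟨y, hyX, hy.resolve_left hyX, h2, hq⟩
  · exfalso
    apply hfree
    refine ⟨_, indPath_app hq hxy2 ?_ ?_, ?_⟩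
    · intro i hi h
      by_cases hik : i = k + 2
      · subst hik; exact hxy2.ne h
      · exact hy2R (Finset.mem_image.2 ⟨i, by simp; omega, h⟩)
    · intro i hi
      exact hy2adj _ (Finset.mem_image.2 ⟨i, by simp; omega, rfl⟩)
    · intro i hi
      by_cases hik : i = k + 2 + 1
      · subst hik; rw [Function.update_self]; exact hy2S
      · rw [Function.update_of_ne hik]
        exact hY.1 (hqY i (by omega))

open Classical in
lemma cds_path {S : Finset V} {n m : ℕ} (hn : 2 ≤ n)
    (hfree : ¬ ∃ p, IndPath G (n + 2) p ∧ ∀ i < n + 2, p i ∈ S)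
    (hmin : ∀ X, CDS G S X → m ≤ X.card)
    {X : Finset V} (hX : CDS G S X) (hm : X.card = m) {p : ℕ → V} (hp : IndPath G n p)
    (hpX : ∀ i < n, p i ∈ X) : ∀ z ∈ X, ∃ i < n, p i = z := by
  by_contra hcon
  push Not at hcon
  have key : ∀ t, ∃ X p, CDS G S X ∧ X.card = m ∧ IndPath G n p ∧ (∀ i < n, p i ∈ X) ∧
      (∃ z ∈ X, ∀ i < n, p i ≠ z) ∧
      ∀ z ∈ X, (∀ i < n, p i ≠ z) → ∀ j < n, j < t → ¬ G.Adj (p j) z := by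
    intro t
    induction t with
    | zero => exact ⟨X, p, hX, hm, hp, hpX, hcon, fun _ _ _ _ _ h => absurd h (by omega)⟩
    | succ t ih =>
      obtain ⟨X, p, hX, hm, hp, hpX, ⟨z, hzX, hzp⟩, hj⟩ := ih
      obtain ⟨y, hyX, hypriv, hcds, hq⟩ := rotate hn hfree hmin hX hm hp hpX
      have hlast : p (n - 1) ∈ X := hpX _ (by omega)
      have hylast : y ≠ p (n - 1) := fun h => hyX (h ▸ hlast)
      refine ⟨_, pre y p, hcds, ?_, fun i j h1 h2 => hq i j h1 (by omega), ?_, ?_, ?_⟩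
      · rw [Finset.card_erase_of_mem (Finset.mem_insert_of_mem hlast),
          Finset.card_insert_of_notMem hyX]
        simpa using hm
      · intro i hi
        rw [Finset.mem_erase]
        cases i with
        | zero => exact ⟨hylast, Finset.mem_insert_self _ _⟩
        | succ i => exact ⟨(hp i (n - 1) (by omega) (by omega)).1,
            Finset.mem_insert_of_mem (hpX i (by omega))⟩
      · refine ⟨z, Finset.mem_erase.2 ⟨(hzp _ (by omega)).symm, Finset.mem_insert_of_mem hzX⟩, ?_⟩
        intro i hi
        cases i with
        | zero => exact fun h => hyX (by rw [show y = z from h]; exact hzX)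
        | succ i => exact hzp i (by omega)
      · intro w hw hwp j hjn hjt
        obtain ⟨hw1, hw2⟩ := Finset.mem_erase.1 hw
        have hwy : w ≠ y := fun h => hwp 0 (by omega) h.symm
        have hwX : w ∈ X := (Finset.mem_insert.1 hw2).resolve_left hwy
        have hwp' : ∀ i < n, p i ≠ w := by
          intro i hi
          by_cases hin : i = n - 1
          · subst hin; exact hw1.symm
          · exact hwp (i + 1) (by omega)
        cases j with
        | zero => exact hypriv w hwX (hwp' 0 (by omega)).symm
        | succ j => exact hj w hwX hwp' j (by omega) (by omega)
  obtain ⟨X, p, hX, hm, hp, hpX, ⟨z, hzX, hzp⟩, hj⟩ := key n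
  obtain ⟨a, ha, b, hb, hbA, hab⟩ := hX.2.1 ((Finset.range n).image p)
    (by
      intro z hz
      obtain ⟨i, hi, rfl⟩ := Finset.mem_image.1 hz
      exact hpX _ (Finset.mem_range.1 hi))
    ⟨p 0, Finset.mem_image.2 ⟨0, by simp; omega, rfl⟩⟩
    (by
      intro h
      rw [← h] at hzX
      obtain ⟨i, hi, h'⟩ := Finset.mem_image.1 hzX
      exact hzp i (Finset.mem_range.1 hi) h')
  obtain ⟨i, hi, rfl⟩ := Finset.mem_image.1 ha
  have hi := Finset.mem_range.1 hi
  exact hj b hb (fun i hi h => hbA (Finset.mem_image.2 ⟨i, Finset.mem_range.2 hi, h⟩)) i hi hi hab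

lemma walk_path {n : ℕ} {p : ℕ → V} (h : ∀ i, i + 1 < n → G.Adj (p i) (p (i + 1))) (i d : ℕ)
    (hd : i + d < n) : ∃ w : G.Walk (p i) (p (i + d)), w.length = d := by
  induction d with
  | zero => exact ⟨Walk.nil, rfl⟩
  | succ d ih =>
    obtain ⟨w, hw⟩ := ih (by omega)
    exact ⟨w.concat (h (i + d) (by omega)), by simp [hw]⟩

open Classical in
lemma radius (n : ℕ) : ∀ S : Finset V, S.Nonempty → Conn G S →
    (¬ ∃ p, IndPath G n p ∧ ∀ i < n, p i ∈ S) →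
    ∃ c ∈ S, ∀ s ∈ S, ∃ w : G.Walk s c, w.length ≤ n / 2 := by
  induction n using Nat.strong_induction_on with
  | _ n ih =>
  intro S hne hS hfree
  obtain ⟨c, hc⟩ := hne
  by_cases hn : n ≤ 3
  · have hn2 : 2 ≤ n := by
      by_contra hlt
      exact hfree ⟨fun _ => c, fun i j h1 h2 => by omega, fun _ _ => hc⟩
    have hall : ∀ s ∈ S, s = c ∨ G.Adj s c := by
      by_contra hcon
      push Not at hcon
      obtain ⟨s, hs, hsc, hsn⟩ := hcon
      obtain ⟨a, ha, b, hb, hbA, hab⟩ := hS (S.filter fun s => s = c ∨ G.Adj s c)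
        (Finset.filter_subset _ _) ⟨c, by simp [hc]⟩
        (by
          intro h
          rw [← h] at hs
          rcases (Finset.mem_filter.1 hs).2 with h | h
          · exact hsc h
          · exact hsn h)
      obtain ⟨haS, ha⟩ := Finset.mem_filter.1 ha
      have hb' : b ≠ c ∧ ¬ G.Adj b c := by
        constructor
        · intro h; exact hbA (Finset.mem_filter.2 ⟨hb, Or.inl h⟩)
        · intro h; exact hbA (Finset.mem_filter.2 ⟨hb, Or.inr h⟩)
      have hac : G.Adj a c := by
        rcases ha with rfl | h
        · exact absurd hab.symm hb'.2
        · exact h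
      have hcb : ¬ G.Adj c b := fun h => hb'.2 h.symm
      apply hfree
      refine ⟨pre c (pre a fun _ => b), ?_, ?_⟩
      · intro i j hij hj
        have : (i = 0 ∧ j = 1) ∨ (i = 0 ∧ j = 2) ∨ (i = 1 ∧ j = 2) := by omega
        rcases this with ⟨rfl, rfl⟩ | ⟨rfl, rfl⟩ | ⟨rfl, rfl⟩
        · simp [pre, hac.symm, hac.symm.ne]
        · simp [pre, hcb, hb'.1.symm]
        · simp [pre, hab, hab.ne]
      · intro i hi
        match i with
        | 0 => exact hc
        | 1 => exact haS
        | i + 2 => exact hb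
    refine ⟨c, hc, fun s hs => ?_⟩
    rcases hall s hs with rfl | h
    · exact ⟨Walk.nil, by simp⟩
    · exact ⟨h.toWalk, by simp; omega⟩
  · obtain ⟨k, rfl⟩ : ∃ k, n = k + 2 := ⟨n - 2, by omega⟩
    have hex : ∃ m, ∃ X, CDS G S X ∧ X.card = m :=
      ⟨_, S, ⟨Finset.Subset.refl _, hS, fun s hs => Or.inl hs⟩, rfl⟩
    obtain ⟨X, hX, hm⟩ := Nat.find_spec hex
    have hmin : ∀ X', CDS G S X' → Nat.find hex ≤ X'.card := fun X' hX' =>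
      Nat.find_min' hex ⟨X', hX', rfl⟩
    have hXne : X.Nonempty := by
      rcases hX.2.2 c hc with h | ⟨x, h, -⟩
      · exact ⟨_, h⟩
      · exact ⟨_, h⟩
    have hXr : ∃ c ∈ X, ∀ s ∈ X, ∃ w : G.Walk s c, w.length ≤ k / 2 := by
      by_cases hpf : ∃ p, IndPath G k p ∧ ∀ i < k, p i ∈ X
      · obtain ⟨p, hp, hpX⟩ := hpf
        have hall := cds_path (by omega) hfree hmin hX hm hp hpX
        have hadj : ∀ i, i + 1 < k → G.Adj (p i) (p (i + 1)) := fun i hi =>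
          (hp i (i + 1) (by omega) hi).2.2 rfl
        refine ⟨p (k / 2), hpX _ (by omega), fun s hs => ?_⟩
        obtain ⟨i, hi, rfl⟩ := hall s hs
        rcases Nat.le_total i (k / 2) with h | h
        · have hh := walk_path hadj i (k / 2 - i) (by omega)
          rw [show i + (k / 2 - i) = k / 2 by omega] at hh
          obtain ⟨w, hw⟩ := hh
          exact ⟨w, by omega⟩
        · have hh := walk_path hadj (k / 2) (i - k / 2) (by omega)
          rw [show k / 2 + (i - k / 2) = i by omega] at hh
          obtain ⟨w, hw⟩ := hh
          exact ⟨w.reverse, by rw [Walk.length_reverse]; omega⟩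
      · exact ih k (by omega) X hXne hX.2.1 hpf
    obtain ⟨c, hcX, hw⟩ := hXr
    refine ⟨c, hX.1 hcX, fun s hs => ?_⟩
    rcases hX.2.2 s hs with h | ⟨x, hx, h⟩
    · obtain ⟨w, hw⟩ := hw s h
      exact ⟨w, by omega⟩
    · obtain ⟨w, hw⟩ := hw x hx
      exact ⟨Walk.cons h w, by rw [Walk.length_cons]; omega⟩

lemma conn_univ [Fintype V] (hconn : G.Connected) : Conn G Finset.univ := by
  intro A _ hne hneq
  by_contra hcon
  push Not at hcon
  obtain ⟨a, ha⟩ := hne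
  apply hneq
  rw [Finset.eq_univ_iff_forall]
  intro b
  have hstep : ∀ u v : V, ∀ w : G.Walk u v, u ∈ A → v ∈ A := by
    intro u v w
    induction w with
    | nil => exact id
    | cons h _ ih =>
      intro hu
      apply ih
      by_contra hv
      exact hcon _ hu _ (Finset.mem_univ _) hv h
  obtain ⟨w⟩ := hconn.preconnected a b
  exact hstep a b w ha

end BurnAux

/-- A connected `P_k`-free graph (no induced path on `k` vertices), `k ≥ 2`, has burning
number at most `⌈(k+1)/2⌉`. -/
theorem burningNumber_le_of_pathFree {V : Type*} [Fintype V] (k : ℕ) (hk : 2 ≤ k)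
    (G : SimpleGraph V) (hconn : G.Connected)
    (hfree : IsEmpty (pathGraph k ↪g G)) :
    burningNumber G ≤ (k + 2) / 2 := by
  obtain ⟨v0⟩ := hconn.nonempty
  obtain ⟨c, -, hc⟩ := BurnAux.radius (G := G) k Finset.univ ⟨v0, Finset.mem_univ _⟩
    (BurnAux.conn_univ hconn) (by
      rintro ⟨p, hp, -⟩
      have hinj : Function.Injective fun i : Fin k => p i := by
        intro i j hij
        by_contra hne
        have hne' : (i : ℕ) ≠ j := fun h => hne (Fin.ext h)
        rcases Nat.lt_or_gt_of_ne hne' with h | h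
        · exact (hp i j h j.2).1 hij
        · exact (hp j i h i.2).1 hij.symm
      refine hfree.false ⟨⟨fun i => p i, hinj⟩, ?_⟩
      intro i j
      change G.Adj (p i) (p j) ↔ _
      rw [pathGraph_adj]
      rcases Nat.lt_trichotomy (i : ℕ) j with h | h | h
      · rw [(hp i j h j.2).2]; omega
      · rw [h]; simp
      · rw [G.adj_comm, (hp j i h i.2).2]; omega)
  apply Nat.sInf_le
  refine ⟨fun _ => c, fun v => ?_⟩
  obtain ⟨w, hw⟩ := hc v (Finset.mem_univ _)
  exact ⟨⟨0, by omega⟩, w, by simp only; omega⟩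
end

section
/- For every integer r ≥ 2, the spider 𝔓_r, consisting of one center vertex with r legs attached, where each leg is a path with r − 1 edges from the center to a leaf, has burning number b(𝔓_r) = r. -/
open SimpleGraph

/-- The spider `𝔓_r`: a center vertex (`none`) with `r` legs, each leg being a path with
`r - 1` edges from the center to a leaf; `some (i, j)` is the `(j + 1)`-st vertex along
leg `i`, counted from the center. -/
def spider (r : ℕ) : SimpleGraph (Option (Fin r × Fin (r - 1))) :=
  SimpleGraph.fromRel (fun x y =>
    match x, y with
    | none, some (_, j) => (j : ℕ) = 0
    | some (i, j), some (i', j') => i = i' ∧ (j' : ℕ) = (j : ℕ) + 1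
    | _, _ => False)

/-- signed height relative to leg `i` -/
def spPot (r : ℕ) (i : Fin r) : Option (Fin r × Fin (r - 1)) → ℤ
  | none => 0
  | some (a, j) => if a = i then (j : ℤ) + 1 else -((j : ℤ) + 1)

theorem spPot_adj (r : ℕ) (i : Fin r) (x y) (h : (spider r).Adj x y) :
    |spPot r i x - spPot r i y| ≤ 1 := by
  rw [spider, SimpleGraph.fromRel_adj] at h
  obtain ⟨-, h⟩ := h
  rw [abs_le]
  rcases x with _ | ⟨a, j⟩ <;> rcases y with _ | ⟨a', j'⟩ <;> simp only [spPot, or_false, false_or] at h ⊢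
  · split_ifs <;> omega
  · split_ifs <;> omega
  · rcases h with ⟨rfl, h⟩ | ⟨rfl, h⟩ <;> split_ifs <;> omega

theorem spPot_walk (r : ℕ) (i : Fin r) {x y} (w : (spider r).Walk x y) :
    |spPot r i x - spPot r i y| ≤ w.length := by
  induction w with
  | nil => simp
  | cons h p ih =>
    have h1 := spPot_adj r i _ _ h
    rw [abs_le] at *
    rw [SimpleGraph.Walk.length_cons]
    push_cast
    constructor <;> linarith [h1.1, h1.2, ih.1, ih.2]

theorem spider_walk (r : ℕ) (i : Fin r) (n : ℕ) (hn : n < r - 1) :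
    ∃ w : (spider r).Walk (some (i, ⟨n, hn⟩)) none, w.length = n + 1 := by
  induction n with
  | zero =>
    have h : (spider r).Adj (some (i, ⟨0, hn⟩)) none := by
      rw [spider, SimpleGraph.fromRel_adj]; simp
    exact ⟨.cons h .nil, by simp⟩
  | succ n ih =>
    obtain ⟨w, hw⟩ := ih (by omega)
    have h : (spider r).Adj (some (i, ⟨n + 1, hn⟩)) (some (i, ⟨n, by omega⟩)) := by
      rw [spider, SimpleGraph.fromRel_adj]; simp
    exact ⟨.cons h w, by simp [hw]⟩

/-- For `r ≥ 2`, the spider `𝔓_r` has burning number `r`. -/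
theorem burningNumber_spider (r : ℕ) (hr : 2 ≤ r) :
    burningNumber (spider r) = r := by
  have hmem : r ∈ {k : ℕ | ∃ b : Fin k → _, IsBurningSeq (spider r) b} := by
    refine ⟨fun _ => none, ?_⟩
    rintro (_ | ⟨i, ⟨n, hn⟩⟩)
    · exact ⟨⟨0, by omega⟩, .nil, by simp; omega⟩
    · obtain ⟨w, hw⟩ := spider_walk r i n hn
      exact ⟨⟨0, by omega⟩, w, by simp [hw]; omega⟩
  refine le_antisymm (Nat.sInf_le hmem) (le_csInf ⟨r, hmem⟩ ?_)
  rintro k ⟨b, hb⟩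
  by_contra! hk
  choose f w hw using fun i : Fin r => hb (some (i, ⟨r - 2, by omega⟩))
  obtain ⟨i, i', hne, he⟩ := Fintype.exists_ne_map_eq_of_card_lt f (by simpa using hk)
  have h1 := spPot_walk r i (w i)
  have h2 := spPot_walk r i (w i')
  have h3 := hw i
  have h4 := hw i'
  have h5 : spPot r i (b (f i)) = spPot r i (b (f i')) := by rw [he]
  rw [abs_le] at h1 h2
  have e1 : spPot r i (some (i, ⟨r - 2, by omega⟩)) = ((r - 2 : ℕ) : ℤ) + 1 := by simp [spPot]
  have e2 : spPot r i (some (i', ⟨r - 2, by omega⟩)) = -(((r - 2 : ℕ) : ℤ) + 1) := by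
    simp only [spPot, if_neg hne.symm]
  rw [e1] at h1
  rw [e2] at h2
  omega
end
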